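/- Let k be a field of characteristic zero and G a finite group. If V and W are two faithful finite-dimensional linear representations of G over k, then k(V)^G is stably pure over k if and only if k(W)^G is stably pure over k. In other words, the stable purity of the field of invariants of a faithful linear representation depends only on G. -/

import Mathlib

open MvPolynomial

universe u

/-- Galois descent for vector spaces: if a finite group acts faithfully on a field `K` and
semilinearly on a `K`-vector space, then the invariant vectors span. -/
theorem span_invariants_eq_top {K V G : Type*} [Field K] [AddCommGroup V] [Module K V]
    [Group G] [Finite G] (a : G → K →+* K) (ha : Function.Injective a)
    (s : G → V →+ V) (hs_one : ∀ v, s 1 v = v) (hs_mul : ∀ g h v, s (g * h) v = s g (s h v))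
    (hs : ∀ g (c : K) v, s g (c • v) = a g c • s g v) :
    Submodule.span K {v : V | ∀ g, s g v = v} = ⊤ := by
  have := Fintype.ofFinite G
  by_contra h
  obtain ⟨f, hf, hle⟩ := Submodule.exists_le_ker_of_lt_top _ (lt_top_iff_ne_top.2 h)
  refine hf (LinearMap.ext fun v ↦ ?_)
  have hli : LinearIndependent K fun g ↦ (⇑(a g : K →* K) : K → K) :=
    (linearIndependent_monoidHom K K).comp (fun g ↦ (a g : K →* K)) fun g h hgh ↦
      ha (RingHom.ext fun x ↦ DFunLike.congr_fun hgh x)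
  have key := Fintype.linearIndependent_iff.1 hli (fun g ↦ f (s g v)) (by
    ext c
    have hmem : ∑ g, s g (c • v) ∈ {v : V | ∀ g, s g v = v} := fun g ↦ by
      rw [map_sum]
      simp only [← hs_mul]
      exact Fintype.sum_equiv (Equiv.mulLeft g) _ _ fun _ ↦ rfl
    have := hle (Submodule.subset_span hmem)
    simpa [hs, mul_comm] using this) 1
  simpa [hs_one] using key

theorem Algebra.isAlgebraic_adjoin_of_intermediateField_adjoin_eq_top {F E : Type*} [Field F]
    [Field E] [Algebra F E] {S : Set E} (hS : IntermediateField.adjoin F S = ⊤) :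
    Algebra.IsAlgebraic (Algebra.adjoin F S) E := by
  refine ⟨fun x ↦ ?_⟩
  obtain ⟨r, hr, s, hs, rfl⟩ := IntermediateField.mem_adjoin_iff_div.1
    (hS ▸ IntermediateField.mem_top : x ∈ IntermediateField.adjoin F S)
  rw [div_eq_mul_inv]
  exact (isAlgebraic_algebraMap (⟨r, hr⟩ : Algebra.adjoin F S)).mul
    (isAlgebraic_algebraMap (⟨s, hs⟩ : Algebra.adjoin F S)).inv

/-- A basis of `K ^ m` consisting of vectors `v` for which `∑ v i • y i` is invariant. -/
theorem exists_basis_invariant {k K G : Type*} [Field k] [Field K] [Algebra k K]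
    [Group G] [Finite G] {m : ℕ} (a : G →* (K ≃ₐ[k] K)) (ha : Function.Injective a)
    (ρ : G →* Matrix.GeneralLinearGroup (Fin m) k) :
    ∃ B : Module.Basis (Fin m) K (Fin m → K), ∀ g i j,
      ∑ l, a g (B i l) * algebraMap k K ((ρ g⁻¹ : Matrix (Fin m) (Fin m) k) l j) = B i j := by
  let s (g : G) : (Fin m → K) →+ (Fin m → K) :=
    { toFun := fun v j ↦
        ∑ l, a g (v l) * algebraMap k K ((ρ g⁻¹ : Matrix (Fin m) (Fin m) k) l j)
      map_zero' := by ext; simp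
      map_add' := fun v w ↦ by ext; simp [add_mul, Finset.sum_add_distrib] }
  have hs (g v j) : s g v j =
      ∑ l, a g (v l) * algebraMap k K ((ρ g⁻¹ : Matrix (Fin m) (Fin m) k) l j) := rfl
  have hs_mul (g h : G) (v : Fin m → K) : s (g * h) v = s g (s h v) := by
    ext j
    simp only [hs, mul_inv_rev, map_mul, AlgEquiv.mul_apply, Units.val_mul, Matrix.mul_apply,
      map_sum, Finset.mul_sum, AlgEquiv.commutes, Finset.sum_mul, mul_assoc]
    rw [Finset.sum_comm]
  have hspan := span_invariants_eq_top (fun g ↦ (a g : K →+* K))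
    (fun g h hgh ↦ ha (AlgEquiv.ext fun x ↦ DFunLike.congr_fun hgh x)) s
    (fun v ↦ by
      ext j
      simp only [hs, inv_one, map_one, Units.val_one, AlgEquiv.one_apply, Matrix.one_apply]
      simp)
    hs_mul
    (fun g c v ↦ by
      ext j
      simp only [hs, Pi.smul_apply, smul_eq_mul, map_mul, Finset.mul_sum, mul_assoc]
      rfl)
  let B₀ := Module.Basis.ofSpan hspan.ge
  have := Module.Finite.finite_basis B₀
  have := Fintype.ofFinite
    ↑((linearIndepOn_empty K id).extend (Set.empty_subset {v : Fin m → K | ∀ g, s g v = v}))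
  have hcard : Fintype.card
      ↑((linearIndepOn_empty K id).extend (Set.empty_subset {v : Fin m → K | ∀ g, s g v = v})) =
      m := by
    rw [← Module.finrank_eq_card_basis B₀]; simp
  refine ⟨B₀.reindex (Fintype.equivFinOfCardEq hcard), fun g i j ↦ ?_⟩
  have hmem : B₀ ((Fintype.equivFinOfCardEq hcard).symm i) ∈
      {v : Fin m → K | ∀ g, s g v = v} :=
    Module.Basis.ofSpan_subset hspan.ge ⟨_, rfl⟩
  rw [Module.Basis.reindex_apply]
  exact congrFun (hmem g) j

/-- Let `L` be generated by a group-stable subfield `K` over a field `M` of invariants, with `K`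
algebraic over `M`. If `M` contains the invariants of `K`, then it contains all invariants
of `L`. -/
theorem mem_of_forall_apply_eq_of_adjoin_eq_top {K L G : Type*} [Field K] [Field L] [CharZero L]
    [Algebra K L] [Group G] [Finite G] (a : G → K →+* K) (b : G →* (L ≃+* L))
    (hab : ∀ g x, b g (algebraMap K L x) = algebraMap K L (a g x))
    {M : Type*} [Field M] [Algebra M L]
    (hM : ∀ g (x : M), b g (algebraMap M L x) = algebraMap M L x)
    (hKM : ∀ c : K, (∀ g, a g c = c) → algebraMap K L c ∈ (algebraMap M L).range)
    (halg : ∀ c : K, IsAlgebraic M (algebraMap K L c))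
    (htop : IntermediateField.adjoin M (Set.range (algebraMap K L)) = ⊤)
    (x : L) (hx : ∀ g, b g x = x) : x ∈ (algebraMap M L).range := by
  have := Fintype.ofFinite G
  have hspan : ∀ x : L, x ∈ Submodule.span M (Set.range (algebraMap K L)) := by
    intro x
    have h1 : x ∈ (IntermediateField.adjoin M (Set.range (algebraMap K L))).toSubalgebra := by
      rw [htop]; trivial
    rw [IntermediateField.adjoin_toSubalgebra_of_isAlgebraic (by rintro _ ⟨c, rfl⟩; exact halg c),
      ← Subalgebra.mem_toSubmodule, Algebra.adjoin_eq_span] at h1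
    have h2 := (MonoidHom.mrange (algebraMap K L : K →* L)).closure_eq
    have h3 : ((MonoidHom.mrange (algebraMap K L : K →* L) : Submonoid L) : Set L) =
      Set.range (algebraMap K L) := by ext; simp
    rw [h3] at h2
    rwa [h2, h3] at h1
  have hinv : ∀ g c, a g (∑ h, a h c) = ∑ h, a h c := by
    intro g c
    apply (algebraMap K L).injective
    rw [← hab, map_sum, map_sum]
    simp only [← hab, ← RingAut.mul_apply, ← map_mul]
    exact Fintype.sum_equiv (Equiv.mulLeft g) _ _ fun _ ↦ rfl
  have havg : ∀ x : L, ∑ g, b g x ∈ (algebraMap M L).range := by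
    intro x
    induction hspan x using Submodule.span_induction with
    | mem x h =>
      obtain ⟨c, rfl⟩ := h
      simp only [hab, ← map_sum]
      exact hKM _ fun g ↦ hinv g c
    | zero => simp
    | add x y _ _ hx hy =>
      simp only [map_add, Finset.sum_add_distrib]
      exact add_mem hx hy
    | smul μ x _ hx =>
      simp only [Algebra.smul_def, map_mul, hM, ← Finset.mul_sum]
      exact mul_mem ⟨μ, rfl⟩ hx
  have h := havg x
  simp only [hx, Finset.sum_const, Finset.card_univ, nsmul_eq_mul] at h
  obtain ⟨c, hc⟩ := h
  refine ⟨c / Fintype.card G, ?_⟩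
  rw [map_div₀, map_natCast, hc, mul_div_cancel_left₀]
  exact_mod_cast Fintype.card_ne_zero

/-- The no-name lemma: if a finite group acts faithfully on `K` and compatibly on `L = K(y)`, with
the transcendence basis `y` spanning a linear representation, then the invariants of `L` form a
rational function field over the invariants of `K`. -/
theorem nonempty_fixedField_algEquiv_fractionRing {k K L : Type u} {G : Type*} [Field k]
    [CharZero k] [Field K] [Field L] [Algebra k K] [Algebra k L] [Algebra K L] [IsScalarTower k K L]
    [Group G] [Finite G] {m : ℕ} (a : G →* (K ≃ₐ[k] K)) (ha : Function.Injective a)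
    (b : G →* (L ≃ₐ[k] L)) (hab : ∀ g x, b g (algebraMap K L x) = algebraMap K L (a g x))
    (ρ : G →* Matrix.GeneralLinearGroup (Fin m) k) (y : Fin m → L)
    (hy : ∀ g i, b g (y i) = ∑ j, ((ρ g⁻¹ : Matrix (Fin m) (Fin m) k) i j) • y j)
    (htop : IntermediateField.adjoin K (Set.range y) = ⊤)
    (hdeg : (m : Cardinal) ≤ Algebra.trdeg K L) :
    Nonempty (IntermediateField.fixedField b.range ≃ₐ[k]
      FractionRing (MvPolynomial (Fin m) (IntermediateField.fixedField a.range))) := by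
  have : CharZero L := charZero_of_injective_algebraMap (algebraMap k L).injective
  obtain ⟨B, hB⟩ := exists_basis_invariant a ha ρ
  let z (i : Fin m) : L := ∑ j, algebraMap K L (B i j) * y j
  have hz_inv (g i) : b g (z i) = z i := by
    simp only [z, map_sum, map_mul, hab, hy, Finset.mul_sum]
    rw [Finset.sum_comm]
    refine Finset.sum_congr rfl fun l _ ↦ ?_
    rw [← hB g i l, map_sum, Finset.sum_mul]
    refine Finset.sum_congr rfl fun j _ ↦ ?_
    rw [map_mul, ← IsScalarTower.algebraMap_apply, Algebra.smul_def, mul_assoc]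
  have hz_top : IntermediateField.adjoin K (Set.range z) = ⊤ := by
    rw [eq_top_iff, ← htop, IntermediateField.adjoin_le_iff]
    rintro _ ⟨j, rfl⟩
    have hyz : y j = ∑ i, algebraMap K L (B.repr (Pi.single j 1) i) * z i := by
      have h := B.sum_repr (Pi.single j 1)
      simp only [z, Finset.mul_sum]
      rw [Finset.sum_comm]
      simp only [← mul_assoc, ← map_mul, ← Finset.sum_mul, ← map_sum]
      have h' (l) : ∑ i, B.repr (Pi.single j 1) i * B i l = (Pi.single j 1 : Fin m → K) l := by
        rw [← congrFun h l]; simp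
      simp only [h', Pi.single_apply]
      simp
    rw [hyz]
    exact sum_mem fun i _ ↦ mul_mem (IntermediateField.algebraMap_mem _ _)
      (IntermediateField.subset_adjoin _ _ ⟨i, rfl⟩)
  have := Algebra.isAlgebraic_adjoin_of_intermediateField_adjoin_eq_top hz_top
  have hz_ind : AlgebraicIndependent K z :=
    (Algebra.IsAlgebraic.isTranscendenceBasis_of_lift_le_trdeg_of_finite K z
      (by simpa using hdeg)).1
  let E := IntermediateField.fixedField a.range
  have hz_indE : AlgebraicIndependent E z := hz_ind.restrictScalars (algebraMap E K).injective
  let M := IntermediateField.adjoin E (Set.range z)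
  have hE (c : K) : (∀ g, a g c = c) ↔ c ∈ E := by
    simp [E, IntermediateField.mem_fixedField_iff]
  have hM (g) (x : L) (hx : x ∈ M) : b g x = x := by
    induction hx using IntermediateField.adjoin_induction with
    | mem x hx => obtain ⟨i, rfl⟩ := hx; exact hz_inv g i
    | algebraMap x =>
      rw [IsScalarTower.algebraMap_apply E K L, hab]
      exact congrArg _ ((hE x).2 x.2 g)
    | add x y _ _ hx hy => rw [map_add, hx, hy]
    | inv x _ hx => rw [map_inv₀, hx]
    | mul x y _ _ hx hy => rw [map_mul, hx, hy]
  have hEK : Algebra.IsInvariant E K a.range :=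
    ⟨fun c h ↦ ⟨⟨c, h⟩, rfl⟩⟩
  have : Finite a.range := .of_surjective _ a.rangeRestrict_surjective
  have hint : Algebra.IsIntegral E K := Algebra.IsInvariant.isIntegral E K a.range
  have hMF : M.restrictScalars k = IntermediateField.fixedField b.range := by
    ext x
    rw [IntermediateField.mem_restrictScalars, IntermediateField.mem_fixedField_iff]
    refine ⟨?_, fun hx ↦ ?_⟩
    · rintro hx _ ⟨g, rfl⟩
      exact hM g x hx
    · have := mem_of_forall_apply_eq_of_adjoin_eq_top (M := M) (fun g ↦ (a g : K →+* K))
        ({ toFun := fun g ↦ (b g : L ≃+* L)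
           map_one' := by rw [map_one]; rfl
           map_mul' := fun g h ↦ by rw [map_mul]; rfl } : G →* (L ≃+* L))
        hab (fun g x ↦ hM g x x.2)
        (fun c hc ↦ ⟨algebraMap E M ⟨c, (hE c).1 hc⟩, rfl⟩)
        (fun c ↦ by
          have h : IsAlgebraic E (algebraMap K L c) :=
            ((hint.isIntegral c).isAlgebraic).algebraMap
          exact h.tower_top M)
        (by
          rw [eq_top_iff]
          intro x _
          have hx : x ∈ IntermediateField.adjoin K (Set.range z) := by rw [hz_top]; trivial
          induction hx using IntermediateField.adjoin_induction with
          | mem x hx =>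
            exact IntermediateField.algebraMap_mem _
              (⟨x, IntermediateField.subset_adjoin _ _ hx⟩ : M)
          | algebraMap x => exact IntermediateField.subset_adjoin _ _ ⟨x, rfl⟩
          | add x y _ _ hx hy => exact add_mem (hx trivial) (hy trivial)
          | inv x _ hx => exact inv_mem (hx trivial)
          | mul x y _ _ hx hy => exact mul_mem (hx trivial) (hy trivial))
        x (fun g ↦ hx _ ⟨g, rfl⟩)
      obtain ⟨c, rfl⟩ := this
      exact c.2
  let e₁ : (M.restrictScalars k) ≃ₐ[k] IntermediateField.fixedField b.range :=
    IntermediateField.equivOfEq hMF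
  let e₂ : FractionRing (MvPolynomial (Fin m) E) ≃ₐ[k] (M.restrictScalars k) :=
    (hz_indE.aevalEquivField).restrictScalars k
  exact ⟨e₁.symm.trans e₂.symm⟩

theorem FractionRing.isTranscendenceBasis_X (σ k : Type*) [Field k] :
    IsTranscendenceBasis k fun i : σ ↦
      algebraMap (MvPolynomial σ k) (FractionRing (MvPolynomial σ k)) (X i) := by
  have : Algebra.IsAlgebraic (MvPolynomial σ k) (FractionRing (MvPolynomial σ k)) :=
    IsLocalization.isAlgebraic _ (nonZeroDivisors (MvPolynomial σ k))
  exact (IsTranscendenceBasis.mvPolynomial σ k).algebraMap_comp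

theorem FractionRing.adjoin_X_eq_top (σ k : Type*) [Field k] :
    IntermediateField.adjoin k (Set.range fun i : σ ↦
      algebraMap (MvPolynomial σ k) (FractionRing (MvPolynomial σ k)) (X i)) = ⊤ := by
  rw [eq_top_iff]
  intro x _
  have hp (p : MvPolynomial σ k) : algebraMap _ (FractionRing (MvPolynomial σ k)) p ∈
      IntermediateField.adjoin k (Set.range fun i : σ ↦
        algebraMap (MvPolynomial σ k) (FractionRing (MvPolynomial σ k)) (X i)) := by
    induction p using MvPolynomial.induction_on with
    | C c => exact IntermediateField.algebraMap_mem _ c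
    | add p q hp hq => rw [map_add]; exact add_mem hp hq
    | mul_X p i hp =>
      rw [map_mul]
      exact mul_mem hp (IntermediateField.subset_adjoin _ _ ⟨i, rfl⟩)
  obtain ⟨p, q, -, rfl⟩ := IsFractionRing.div_surjective (MvPolynomial σ k) x
  exact div_mem (hp p) (hp q)

theorem FractionRing.algHom_ext_of_X {k L : Type*} {σ : Type*} [Field k] [Field L] [Algebra k L]
    {f g : FractionRing (MvPolynomial σ k) →ₐ[k] L}
    (h : ∀ i, f (algebraMap (MvPolynomial σ k) _ (X i)) =
      g (algebraMap (MvPolynomial σ k) _ (X i))) : f = g := by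
  have h' : f.comp (IsScalarTower.toAlgHom k (MvPolynomial σ k) _) =
      g.comp (IsScalarTower.toAlgHom k (MvPolynomial σ k) _) :=
    MvPolynomial.algHom_ext fun i ↦ h i
  refine AlgHom.ext fun x ↦ ?_
  obtain ⟨p, q, -, rfl⟩ := IsFractionRing.div_surjective (MvPolynomial σ k) x
  rw [map_div₀, map_div₀]
  exact congrArg₂ _ (DFunLike.congr_fun h' p) (DFunLike.congr_fun h' q)

/-- A rational function field action induced by a faithful linear representation is faithful. -/
theorem injective_of_apply_X {k G : Type*} [Field k] [Group G] {n : ℕ}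
    (ρ : G →* Matrix.GeneralLinearGroup (Fin n) k) (hρ : Function.Injective ρ)
    (a : G →* (FractionRing (MvPolynomial (Fin n) k) ≃ₐ[k] FractionRing (MvPolynomial (Fin n) k)))
    (ha : ∀ (g : G) (i : Fin n),
      a g (algebraMap (MvPolynomial (Fin n) k) (FractionRing (MvPolynomial (Fin n) k)) (X i)) =
        algebraMap (MvPolynomial (Fin n) k) (FractionRing (MvPolynomial (Fin n) k))
          (∑ j, ((ρ g⁻¹ : Matrix (Fin n) (Fin n) k) i j) • X j)) :
    Function.Injective a := by
  intro g h hgh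
  refine inv_injective (hρ (Units.ext (Matrix.ext fun i j ↦ ?_)))
  have key := ha g i
  rw [hgh, ha h i] at key
  have := congrArg (coeff (Finsupp.single j 1))
    (IsFractionRing.injective (MvPolynomial (Fin n) k) _ key)
  simpa [coeff_sum, coeff_smul, coeff_X, Finsupp.single_left_inj] using this.symm

theorem IntermediateField.adjoin_eq_top_of_adjoin_range_union_eq_top {k K L ι : Type*} [Field k]
    [Field K] [Field L] [Algebra k K] [Algebra k L] [Algebra K L] [IsScalarTower k K L]
    (x : ι → K) {S : Set L}
    (h : IntermediateField.adjoin k ((Set.range fun i ↦ algebraMap K L (x i)) ∪ S) = ⊤) :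
    IntermediateField.adjoin K S = ⊤ := by
  have hle : (⊤ : IntermediateField k L) ≤ (IntermediateField.adjoin K S).restrictScalars k := by
    rw [← h, IntermediateField.adjoin_le_iff]
    rintro _ (⟨i, rfl⟩ | hc)
    · exact (IntermediateField.adjoin K S).algebraMap_mem _
    · exact IntermediateField.subset_adjoin K S hc
  exact eq_top_iff.2 fun c _ ↦ hle trivial

/-- The no-name lemma for a rational function field `k(V)` embedded in a field generated by
coordinates on `V` and on another representation. -/
theorem nonempty_fixedField_algEquiv_of_coordinates {k L : Type u} {G : Type*} [Field k]
    [CharZero k] [Field L] [Algebra k L] [Group G] [Finite G] {n m : ℕ}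
    (ρV : G →* Matrix.GeneralLinearGroup (Fin n) k) (hρV : Function.Injective ρV)
    (ρW : G →* Matrix.GeneralLinearGroup (Fin m) k)
    (a : G →* (FractionRing (MvPolynomial (Fin n) k) ≃ₐ[k] FractionRing (MvPolynomial (Fin n) k)))
    (ha : ∀ (g : G) (i : Fin n),
      a g (algebraMap (MvPolynomial (Fin n) k) (FractionRing (MvPolynomial (Fin n) k)) (X i)) =
        algebraMap (MvPolynomial (Fin n) k) (FractionRing (MvPolynomial (Fin n) k))
          (∑ j, ((ρV g⁻¹ : Matrix (Fin n) (Fin n) k) i j) • X j))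
    (b : G →* (L ≃ₐ[k] L)) (x : Fin n → L) (y : Fin m → L)
    (hx : ∀ g i, b g (x i) = ∑ j, ((ρV g⁻¹ : Matrix (Fin n) (Fin n) k) i j) • x j)
    (hy : ∀ g i, b g (y i) = ∑ j, ((ρW g⁻¹ : Matrix (Fin m) (Fin m) k) i j) • y j)
    (hind : AlgebraicIndependent k x)
    (htop : IntermediateField.adjoin k (Set.range x ∪ Set.range y) = ⊤)
    (hdeg : Algebra.trdeg k L = (n + m : ℕ)) :
    Nonempty (IntermediateField.fixedField b.range ≃ₐ[k]
      FractionRing (MvPolynomial (Fin m) (IntermediateField.fixedField a.range))) := by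
  let K := FractionRing (MvPolynomial (Fin n) k)
  let φ : K →ₐ[k] L :=
    IsFractionRing.liftAlgHom (g := aeval x) (algebraicIndependent_iff_injective_aeval.1 hind)
  have hφ (p : MvPolynomial (Fin n) k) : φ (algebraMap _ _ p) = aeval x p :=
    IsFractionRing.lift_algebraMap (algebraicIndependent_iff_injective_aeval.1 hind) p
  let _ : Algebra K L := φ.toRingHom.toAlgebra
  have : IsScalarTower k K L := .of_algebraMap_eq fun c ↦ (φ.commutes c).symm
  refine nonempty_fixedField_algEquiv_fractionRing a (injective_of_apply_X ρV hρV a ha) b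
    (fun g c ↦ ?_) ρW y hy ?_ ?_
  · have : ((b g : L →ₐ[k] L).comp φ) = φ.comp (a g : K →ₐ[k] K) :=
      FractionRing.algHom_ext_of_X fun i ↦ by
        have h := ha g i
        change b g (φ _) = φ (a g _)
        rw [h, hφ, hφ, aeval_X, hx]
        simp
    exact DFunLike.congr_fun this c
  · refine IntermediateField.adjoin_eq_top_of_adjoin_range_union_eq_top (k := k)
      (fun i ↦ algebraMap (MvPolynomial (Fin n) k) K (X i)) ?_
    have h : (fun i ↦ algebraMap K L (algebraMap (MvPolynomial (Fin n) k) K (X i))) = x :=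
      funext fun i ↦ (hφ _).trans (aeval_X _ _)
    rwa [h]
  · have h : Algebra.trdeg k K + Algebra.trdeg K L = Algebra.trdeg k L := trdeg_add_eq k K
    have hK : Algebra.trdeg k K = n := by
      have := (FractionRing.isTranscendenceBasis_X (Fin n) k).lift_cardinalMk_eq_trdeg
      simpa using this.symm
    rw [hdeg, hK, Nat.cast_add] at h
    exact (Cardinal.eq_of_add_eq_add_left h Cardinal.natCast_lt_aleph0).ge

/-- The action on a rational function field of a group acting linearly on the variables. -/
theorem exists_linear_action {k G ι : Type*} [Field k] [Group G] [Fintype ι] [DecidableEq ι]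
    (ρ : G →* Matrix ι ι k) :
    ∃ b : G →* (FractionRing (MvPolynomial ι k) ≃ₐ[k] FractionRing (MvPolynomial ι k)),
      ∀ g i, b g (algebraMap (MvPolynomial ι k) _ (X i)) =
        ∑ j, ρ g⁻¹ i j • algebraMap (MvPolynomial ι k) (FractionRing (MvPolynomial ι k)) (X j) := by
  let c : G →* (MvPolynomial ι k →ₐ[k] MvPolynomial ι k) :=
    { toFun := fun g ↦ aeval fun i ↦ ∑ j, ρ g⁻¹ i j • X j
      map_one' := by
        refine MvPolynomial.algHom_ext fun i ↦ ?_
        simp [Matrix.one_apply]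
      map_mul' := fun g h ↦ by
        refine MvPolynomial.algHom_ext fun i ↦ ?_
        simp only [AlgHom.mul_apply, aeval_X, map_sum, map_smul, mul_inv_rev, map_mul,
          Matrix.mul_apply, Finset.sum_smul, Finset.smul_sum, smul_smul]
        rw [Finset.sum_comm] }
  refine ⟨(IsFractionRing.fieldEquivOfAlgEquivHom k _).comp
    ((AlgEquiv.algHomUnitsEquiv k _).toMonoidHom.comp c.toHomUnits), fun g i ↦ ?_⟩
  have h : c g (X i) = ∑ j, ρ g⁻¹ i j • X j := aeval_X _ _
  refine (IsFractionRing.fieldEquivOfAlgEquiv_algebraMap k _ _ _ (X i)).trans ?_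
  refine (congrArg _ h).trans ?_
  simp only [map_sum, Algebra.smul_def, map_mul]
  rfl

/-- Iterated rational function fields are rational function fields. -/
theorem nonempty_fractionRing_mvPolynomial_algEquiv (E : Type*) [Field E] (r m : ℕ) :
    Nonempty (FractionRing (MvPolynomial (Fin (r + m)) E) ≃ₐ[E]
      FractionRing (MvPolynomial (Fin r) (FractionRing (MvPolynomial (Fin m) E)))) := by
  let F := FractionRing (MvPolynomial (Fin m) E)
  let B := FractionRing (MvPolynomial (Fin r) F)
  let x (i : Fin m) : F := algebraMap (MvPolynomial (Fin m) E) F (X i)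
  let y (i : Fin r) : B := algebraMap (MvPolynomial (Fin r) F) B (X i)
  have hx : AlgebraicIndependent E x :=
    (FractionRing.isTranscendenceBasis_X (Fin m) E).1
  have hy : AlgebraicIndependent F y :=
    (FractionRing.isTranscendenceBasis_X (Fin r) F).1
  have hxy := (algebraicIndependent_equiv finSumFinEquiv.symm).2 (hx.sumElim_comp hy)
  have htop : IntermediateField.adjoin E
      (Set.range (Sum.elim y (algebraMap F B ∘ x) ∘ finSumFinEquiv.symm)) = ⊤ := by
    rw [EquivLike.range_comp, Set.Sum.elim_range, Set.range_comp]
    set M := IntermediateField.adjoin E (Set.range y ∪ algebraMap F B '' Set.range x)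
    have hF (c : F) : algebraMap F B c ∈ M := by
      have hc : c ∈ IntermediateField.adjoin E (Set.range x) :=
        (FractionRing.adjoin_X_eq_top (Fin m) E).ge trivial
      have hle : IntermediateField.adjoin E (Set.range x) ≤
          M.comap (IsScalarTower.toAlgHom E F B) := by
        rw [IntermediateField.adjoin_le_iff]
        exact fun c hc ↦ IntermediateField.subset_adjoin E _ (.inr ⟨c, hc, rfl⟩)
      exact hle hc
    let M' : IntermediateField F B := { M with algebraMap_mem' := hF }
    have hle : IntermediateField.adjoin F (Set.range y) ≤ M' := by
      rw [IntermediateField.adjoin_le_iff]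
      exact fun c hc ↦ IntermediateField.subset_adjoin E _ (.inl hc)
    exact eq_top_iff.2 fun c _ ↦ hle ((FractionRing.adjoin_X_eq_top (Fin r) F).ge trivial)
  exact ⟨hxy.aevalEquivField.trans
    ((IntermediateField.equivOfEq htop).trans IntermediateField.topEquiv)⟩

theorem nonempty_fractionRing_mvPolynomial_congr {k E F : Type*} [Field k] [Field E] [Field F]
    [Algebra k E] [Algebra k F] (e : E ≃ₐ[k] F) (r : ℕ) :
    Nonempty (FractionRing (MvPolynomial (Fin r) E) ≃ₐ[k] FractionRing (MvPolynomial (Fin r) F)) :=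
  ⟨IsFractionRing.fieldEquivOfAlgEquiv k _ _ (MvPolynomial.mapAlgEquiv (Fin r) e)⟩

/-- Stable purity is unaffected by adjoining finitely many indeterminates. -/
theorem stablyPure_iff_of_algEquiv_fractionRing {k E F : Type*} [Field k] [Field E] [Field F]
    [Algebra k E] [Algebra k F] {m : ℕ}
    (e : F ≃ₐ[k] FractionRing (MvPolynomial (Fin m) E)) :
    (∃ r t : ℕ, Nonempty (FractionRing (MvPolynomial (Fin r) E) ≃ₐ[k]
      FractionRing (MvPolynomial (Fin t) k))) ↔
    (∃ r t : ℕ, Nonempty (FractionRing (MvPolynomial (Fin r) F) ≃ₐ[k]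
      FractionRing (MvPolynomial (Fin t) k))) := by
  constructor
  · rintro ⟨r, t, ⟨f⟩⟩
    obtain ⟨e₁⟩ := nonempty_fractionRing_mvPolynomial_congr e r
    obtain ⟨e₂⟩ := nonempty_fractionRing_mvPolynomial_algEquiv E r m
    obtain ⟨e₃⟩ := nonempty_fractionRing_mvPolynomial_algEquiv E m r
    obtain ⟨e₄⟩ := nonempty_fractionRing_mvPolynomial_congr f m
    obtain ⟨e₅⟩ := nonempty_fractionRing_mvPolynomial_algEquiv k m t
    rw [add_comm m r] at e₃
    exact ⟨r, m + t, ⟨e₁.trans <| (e₂.symm.restrictScalars k).trans <|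
      (e₃.restrictScalars k).trans <| e₄.trans e₅.symm⟩⟩
  · rintro ⟨r, t, ⟨f⟩⟩
    obtain ⟨e₁⟩ := nonempty_fractionRing_mvPolynomial_congr e r
    obtain ⟨e₂⟩ := nonempty_fractionRing_mvPolynomial_algEquiv E r m
    exact ⟨r + m, t, ⟨(e₂.restrictScalars k).trans <| e₁.symm.trans f⟩⟩

/-- Let `k` be a field of characteristic zero and `G` a finite group.
If `V = k^n` and `W = k^m` are two faithful linear representations of `G` (given by
injective homomorphisms into `GL` together with the induced actions `aV`, `aW` on the
rational function fields), then `k(V)^G` is stably pure over `k` (i.e. becomes purely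
transcendental over `k` after adjoining finitely many indeterminates) if and only if
`k(W)^G` is stably pure over `k`. -/
theorem stable_purity_of_invariant_field_depends_only_on_group
    (k : Type) [Field k] [CharZero k]
    (G : Type) [Group G] [Finite G]
    (n m : ℕ)
    (ρV : G →* Matrix.GeneralLinearGroup (Fin n) k) (hρV : Function.Injective ρV)
    (ρW : G →* Matrix.GeneralLinearGroup (Fin m) k) (hρW : Function.Injective ρW)
    (aV : G →* (FractionRing (MvPolynomial (Fin n) k) ≃ₐ[k]
      FractionRing (MvPolynomial (Fin n) k)))
    (haV : ∀ (g : G) (i : Fin n),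
      aV g (algebraMap (MvPolynomial (Fin n) k) (FractionRing (MvPolynomial (Fin n) k)) (X i)) =
        algebraMap (MvPolynomial (Fin n) k) (FractionRing (MvPolynomial (Fin n) k))
          (∑ j, ((ρV g⁻¹ : Matrix (Fin n) (Fin n) k) i j) • X j))
    (aW : G →* (FractionRing (MvPolynomial (Fin m) k) ≃ₐ[k]
      FractionRing (MvPolynomial (Fin m) k)))
    (haW : ∀ (g : G) (i : Fin m),
      aW g (algebraMap (MvPolynomial (Fin m) k) (FractionRing (MvPolynomial (Fin m) k)) (X i)) =
        algebraMap (MvPolynomial (Fin m) k) (FractionRing (MvPolynomial (Fin m) k))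
          (∑ j, ((ρW g⁻¹ : Matrix (Fin m) (Fin m) k) i j) • X j)) :
    (∃ r t : ℕ, Nonempty
      (FractionRing (MvPolynomial (Fin r) (IntermediateField.fixedField aV.range)) ≃ₐ[k]
       FractionRing (MvPolynomial (Fin t) k))) ↔
    (∃ r t : ℕ, Nonempty
      (FractionRing (MvPolynomial (Fin r) (IntermediateField.fixedField aW.range)) ≃ₐ[k]
       FractionRing (MvPolynomial (Fin t) k))) := by
  let ρ : G →* Matrix (Fin n ⊕ Fin m) (Fin n ⊕ Fin m) k :=
    { toFun := fun g ↦ Matrix.fromBlocks (ρV g) 0 0 (ρW g)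
      map_one' := by simp
      map_mul' := fun g h ↦ by simp [Matrix.fromBlocks_multiply] }
  obtain ⟨b, hb⟩ := exists_linear_action ρ
  have hbasis := FractionRing.isTranscendenceBasis_X (Fin n ⊕ Fin m) k
  have htop := FractionRing.adjoin_X_eq_top (Fin n ⊕ Fin m) k
  have hdeg := hbasis.lift_cardinalMk_eq_trdeg.symm
  simp only [Cardinal.lift_id, Cardinal.mk_sum, Cardinal.mk_fin, ← Nat.cast_add] at hdeg
  let x (i : Fin n) :=
    algebraMap (MvPolynomial (Fin n ⊕ Fin m) k) (FractionRing (MvPolynomial (Fin n ⊕ Fin m) k))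
      (X (Sum.inl i))
  let y (i : Fin m) :=
    algebraMap (MvPolynomial (Fin n ⊕ Fin m) k) (FractionRing (MvPolynomial (Fin n ⊕ Fin m) k))
      (X (Sum.inr i))
  have hrange : Set.range (fun i : Fin n ⊕ Fin m ↦
      algebraMap (MvPolynomial (Fin n ⊕ Fin m) k) (FractionRing (MvPolynomial (Fin n ⊕ Fin m) k))
        (X i)) =
      Set.range x ∪ Set.range y := by
    rw [← Set.Sum.elim_range]
    congr 1
    ext (i | i) <;> rfl
  rw [hrange] at htop
  have hx (g : G) (i : Fin n) :
      b g (x i) = ∑ j, ((ρV g⁻¹ : Matrix (Fin n) (Fin n) k) i j) • x j := by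
    simp only [x, hb, Fintype.sum_sum_type]
    simp [ρ, -map_inv]
  have hy (g : G) (i : Fin m) :
      b g (y i) = ∑ j, ((ρW g⁻¹ : Matrix (Fin m) (Fin m) k) i j) • y j := by
    simp only [y, hb, Fintype.sum_sum_type]
    simp [ρ, -map_inv]
  obtain ⟨e₁⟩ := nonempty_fixedField_algEquiv_of_coordinates ρV hρV ρW aV haV b x y hx hy
    (hbasis.1.comp _ Sum.inl_injective) htop hdeg
  obtain ⟨e₂⟩ := nonempty_fixedField_algEquiv_of_coordinates ρW hρW ρV aW haW b y x hy hx
    (hbasis.1.comp _ Sum.inr_injective) (by rwa [Set.union_comm]) (by rwa [add_comm])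
  exact (stablyPure_iff_of_algEquiv_fractionRing e₁).trans
    (stablyPure_iff_of_algEquiv_fractionRing e₂).symm
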